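/- For every n ≥ 1, setting ζ_n = Σ_{x ∈ F_{q^n}, x ≠ 0} ρ_{x,0} ∈ V₋, one has for every u ∈ F_{q^n} with u ≠ 0: s·ε(−u)·ζ_n = (q^n + 1)·ρ_{u^{-1},0} + (ε(u^{-1}) − 1)·ζ_n. -/

import Mathlib

noncomputable section

open scoped TensorProduct

namespace SL2X

variable (p : ℕ) [Fact p.Prime]

/-- The algebraic closure of the prime field `𝔽_p`. -/
abbrev F : Type := AlgebraicClosure (ZMod p)

/-- `G = SL₂(F)`. -/
abbrev G : Type := Matrix.SpecialLinearGroup (Fin 2) (F p)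

/-- The unipotent element `ε(x) = [[1,x],[0,1]]`. -/
def eps (x : F p) : G p :=
  ⟨!![1, x; 0, 1], by simp [Matrix.det_fin_two_of]⟩

/-- The torus element `h(t) = diag(t, t⁻¹)`. -/
def h (t : (F p)ˣ) : G p :=
  ⟨!![(t : F p), 0; 0, ((t⁻¹ : (F p)ˣ) : F p)], by simp [Matrix.det_fin_two_of]⟩

/-- The Weyl element `s = [[0,1],[-1,0]]`. -/
def sG : G p :=
  ⟨!![0, 1; -1, 0], by simp [Matrix.det_fin_two_of]⟩

/-- The Borel subgroup `B` of upper triangular matrices in `G`. -/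
def B : Subgroup (G p) where
  carrier := {g | (g : Matrix (Fin 2) (Fin 2) (F p)) 1 0 = 0}
  one_mem' := by simp [Matrix.one_apply]
  mul_mem' := by
    intro a b ha hb
    simp only [Set.mem_setOf_eq] at *
    simp [Matrix.mul_apply, Fin.sum_univ_two, ha, hb]
  inv_mem' := by
    intro a ha
    simp only [Set.mem_setOf_eq] at *
    simp [Matrix.SpecialLinearGroup.coe_inv, Matrix.adjugate_fin_two, ha]

/-- The diagonal part of an element of `B`, as a unit of `F`. -/
def Bdiag (b : B p) : (F p)ˣ where
  val := ((b : G p) : Matrix (Fin 2) (Fin 2) (F p)) 0 0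
  inv := ((b : G p) : Matrix (Fin 2) (Fin 2) (F p)) 1 1
  val_inv := by
    have hdet : ((b : G p) : Matrix (Fin 2) (Fin 2) (F p)).det = 1 := (b : G p).2
    have h10 : ((b : G p) : Matrix (Fin 2) (Fin 2) (F p)) 1 0 = 0 := b.2
    rw [Matrix.det_fin_two, h10, mul_zero, sub_zero] at hdet
    exact hdet
  inv_val := by
    have hdet : ((b : G p) : Matrix (Fin 2) (Fin 2) (F p)).det = 1 := (b : G p).2
    have h10 : ((b : G p) : Matrix (Fin 2) (Fin 2) (F p)) 1 0 = 0 := b.2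
    rw [Matrix.det_fin_two, h10, mul_zero, sub_zero] at hdet
    rw [mul_comm]; exact hdet

variable (k : Type) [Field k] [IsAlgClosed k] [CharZero k]

/-- The group algebra `kG`. -/
abbrev kG : Type := MonoidAlgebra k (G p)

/-- The canonical image of a group element in the group algebra. -/
def γ (g : G p) : kG p k := MonoidAlgebra.of k (G p) g

/-- The submodule of relations defining the induced module
`M(θ) = kG ⊗_{kB} k_θ`, where the character `θ` of `T ≅ Fˣ` is extended to `B`
by letting `U` act trivially. -/
def Nmod (θ : (F p)ˣ →* kˣ) : Submodule (kG p k) (kG p k) :=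
  Submodule.span (kG p k)
    {y | ∃ b : B p, y = γ p k (b : G p) - ((θ (Bdiag p b) : k)) • (1 : kG p k)}

/-- The induced module `M(θ) = kG ⊗_{kB} k_θ`, realized as `kG / N(θ)` where
`N(θ)` is the left submodule generated by the elements `b - θ(b)·1`, `b ∈ B`. -/
def Mmod (θ : (F p)ˣ →* kˣ) : Type := kG p k ⧸ Nmod p k θ

instance (θ : (F p)ˣ →* kˣ) : AddCommGroup (Mmod p k θ) :=
  inferInstanceAs (AddCommGroup (kG p k ⧸ Nmod p k θ))
instance (θ : (F p)ˣ →* kˣ) : Module (kG p k) (Mmod p k θ) :=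
  inferInstanceAs (Module (kG p k) (kG p k ⧸ Nmod p k θ))
instance (θ : (F p)ˣ →* kˣ) : Module k (Mmod p k θ) :=
  inferInstanceAs (Module k (kG p k ⧸ Nmod p k θ))
instance (θ : (F p)ˣ →* kˣ) : IsScalarTower k (kG p k) (Mmod p k θ) :=
  inferInstanceAs (IsScalarTower k (kG p k) (kG p k ⧸ Nmod p k θ))

/-- The canonical generator `1_θ ∈ M(θ)`. -/
def oneθ (θ : (F p)ˣ →* kˣ) : Mmod p k θ :=
  Submodule.Quotient.mk (1 : kG p k)

/-- `η = (1 - s)·1_tr ∈ M(tr)`. -/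
def eta : Mmod p k 1 :=
  Submodule.Quotient.mk ((1 : kG p k) - γ p k (sG p))

/-- The Steinberg module `St = kG·η ⊆ M(tr)`. -/
def St : Submodule (kG p k) (Mmod p k 1) :=
  Submodule.span (kG p k) {eta p k}

/-- `ε(x)·η` as an element of `St`. -/
def E (x : F p) : ↥(St p k) :=
  ⟨γ p k (eps p x) • eta p k,
    Submodule.smul_mem _ _ (Submodule.mem_span_singleton_self _)⟩

/-- The action of a group element on `St`, as a `k`-linear map. -/
def gSt (g : G p) : ↥(St p k) →ₗ[k] ↥(St p k) where
  toFun v := ⟨γ p k g • (v : Mmod p k 1), Submodule.smul_mem _ _ v.2⟩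
  map_add' := by intro a b; apply Subtype.ext; simp [smul_add]
  map_smul' := by
    intro c v; apply Subtype.ext
    simp [smul_comm (γ p k g) c]

/-- `St ⊗_k St`. -/
abbrev StT : Type := ↥(St p k) ⊗[k] ↥(St p k)

/-- The diagonal action of a group element on `St ⊗_k St`. -/
def gTT (g : G p) : StT p k →ₗ[k] StT p k :=
  TensorProduct.map (gSt p k g) (gSt p k g)

/-- `ω_{x,y} = (ε(x)η ⊗ ε(y)η + ε(y)η ⊗ ε(x)η)/2`. -/
def ω (x y : F p) : StT p k :=
  (2 : k)⁻¹ • (E p k x ⊗ₜ[k] E p k y + E p k y ⊗ₜ[k] E p k x)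

/-- `ρ_{x,y} = (ε(x)η ⊗ ε(y)η − ε(y)η ⊗ ε(x)η)/2`. -/
def ρ (x y : F p) : StT p k :=
  (2 : k)⁻¹ • (E p k x ⊗ₜ[k] E p k y - E p k y ⊗ₜ[k] E p k x)

/-- `V₊`, the span of the `ω_{x,y}`. -/
def Vplus : Submodule k (StT p k) :=
  Submodule.span k {v | ∃ x y : F p, v = ω p k x y}

/-- `V₋`, the span of the `ρ_{x,y}` for `x ≠ y`. -/
def Vminus : Submodule k (StT p k) :=
  Submodule.span k {v | ∃ x y : F p, x ≠ y ∧ v = ρ p k x y}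


section

omit [IsAlgClosed k] [CharZero k]

/-- The image of a group element in `M(tr)`, i.e. a point of the projective line `G / B`. -/
def pt (g : G p) : Mmod p k 1 := Submodule.Quotient.mk (γ p k g)

lemma γ_mul (g g' : G p) : γ p k (g * g') = γ p k g * γ p k g' :=
  map_mul (MonoidAlgebra.of k (G p)) g g'

lemma γ_smul_pt (g g' : G p) : γ p k g • pt p k g' = pt p k (g * g') := by
  rw [pt, pt, γ_mul]
  rfl

lemma pt_eq_of_mem {g g' : G p} (hB : g⁻¹ * g' ∈ B p) : pt p k g' = pt p k g := by
  refine (Submodule.Quotient.eq (Nmod p k 1)).2 ?_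
  have hmem : γ p k (g⁻¹ * g') - (1 : kG p k) ∈ Nmod p k 1 := by
    refine Submodule.subset_span ⟨⟨_, hB⟩, ?_⟩
    simp
  have := (Nmod p k 1).smul_mem (γ p k g) hmem
  rwa [smul_eq_mul, mul_sub, ← γ_mul, mul_inv_cancel_left, mul_one] at this

lemma pt_eq {g g' : G p}
    (hg : (g : Matrix (Fin 2) (Fin 2) (F p)) 0 0 *
    (g' : Matrix (Fin 2) (Fin 2) (F p)) 1 0 =
      (g : Matrix (Fin 2) (Fin 2) (F p)) 1 0 * (g' : Matrix (Fin 2) (Fin 2) (F p)) 0 0) : pt p k g' = pt p k g := by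
  apply pt_eq_of_mem
  change ((g⁻¹ * g' : G p) : Matrix (Fin 2) (Fin 2) (F p)) 1 0 = 0
  simp [Matrix.SpecialLinearGroup.coe_inv, Matrix.adjugate_fin_two, Matrix.mul_apply,
    Fin.sum_univ_two]
  linear_combination hg

lemma coe_eps (x : F p) : (eps p x : Matrix (Fin 2) (Fin 2) (F p)) = !![1, x; 0, 1] := rfl

lemma coe_sG : (sG p : Matrix (Fin 2) (Fin 2) (F p)) = !![0, 1; -1, 0] := rfl

lemma eta_eq : eta p k = pt p k 1 - pt p k (sG p) := rfl

lemma coe_E (x : F p) : (E p k x : Mmod p k 1) = pt p k 1 - pt p k (eps p x * sG p) := by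
  change γ p k (eps p x) • eta p k = _
  rw [eta_eq, smul_sub, γ_smul_pt, γ_smul_pt, mul_one]
  congr 1
  apply pt_eq
  simp [coe_eps]

lemma coe_gSt (g : G p) (v : St p k) :
    (gSt p k g v : Mmod p k 1) = γ p k g • (v : Mmod p k 1) := rfl

lemma coe_gSt_E (g : G p) (x : F p) :
    (gSt p k g (E p k x) : Mmod p k 1) = pt p k g - pt p k (g * (eps p x * sG p)) := by
  rw [coe_gSt, coe_E, smul_sub, γ_smul_pt, γ_smul_pt, mul_one]

lemma gSt_eps_E (y x : F p) : gSt p k (eps p y) (E p k x) = E p k (x + y) := by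
  apply Subtype.ext
  rw [coe_gSt_E, coe_E]
  congr 1 <;> apply pt_eq <;>
    simp [coe_eps, coe_sG, Matrix.mul_apply, Fin.sum_univ_two, add_comm]

lemma gSt_s_E_zero : gSt p k (sG p) (E p k 0) = -E p k 0 := by
  apply Subtype.ext
  rw [coe_gSt_E, Submodule.coe_neg, coe_E, neg_sub]
  congr 1 <;> apply pt_eq <;>
    simp [coe_eps, coe_sG, Matrix.mul_apply, Fin.sum_univ_two]

lemma gSt_s_E {x : F p} (hx : x ≠ 0) :
    gSt p k (sG p) (E p k x) = E p k (-x)⁻¹ - E p k 0 := by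
  apply Subtype.ext
  rw [coe_gSt_E, Submodule.coe_sub, coe_E, coe_E, sub_sub_sub_cancel_left]
  congr 1 <;> apply pt_eq <;>
    simp [coe_eps, coe_sG, Matrix.mul_apply, Fin.sum_univ_two, hx]

lemma gTT_ρ (g : G p) (x y : F p) :
    gTT p k g (ρ p k x y) =
      (2 : k)⁻¹ • (gSt p k g (E p k x) ⊗ₜ[k] gSt p k g (E p k y) -
        gSt p k g (E p k y) ⊗ₜ[k] gSt p k g (E p k x)) := by
  simp [gTT, ρ]

end

omit [IsAlgClosed k] in
lemma ρ_swap (x y : F p) : ρ p k x y = -ρ p k y x := by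
  simp only [ρ]
  module

omit [IsAlgClosed k] [CharZero k] in
lemma gTT_eps_ρ (z x y : F p) : gTT p k (eps p z) (ρ p k x y) = ρ p k (x + z) (y + z) := by
  rw [gTT_ρ, gSt_eps_E, gSt_eps_E, ρ]

omit [IsAlgClosed k] in
lemma gTT_s_ρ {x y : F p} (hx : x ≠ 0) (hy : y ≠ 0) :
    gTT p k (sG p) (ρ p k x y) =
      ρ p k (-x)⁻¹ (-y)⁻¹ - ρ p k (-x)⁻¹ 0 + ρ p k (-y)⁻¹ 0 := by
  rw [gTT_ρ, gSt_s_E p k hx, gSt_s_E p k hy]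
  simp only [ρ, TensorProduct.tmul_sub, TensorProduct.sub_tmul]
  module

omit [IsAlgClosed k] in
lemma gTT_s_ρ_zero {y : F p} (hy : y ≠ 0) :
    gTT p k (sG p) (ρ p k 0 y) = ρ p k (-y)⁻¹ 0 := by
  rw [gTT_ρ, gSt_s_E_zero, gSt_s_E p k hy]
  simp only [ρ, TensorProduct.tmul_sub, TensorProduct.sub_tmul, TensorProduct.neg_tmul,
    TensorProduct.tmul_neg]
  module

lemma card_of_mem_iff_pow_eq {r : ℕ} (hr : r ≠ 0) (A : Finset (F p))
    (hA : ∀ x : F p, x ∈ A ↔ x ^ p ^ r = x) : A.card = p ^ r := by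
  have h1 : 1 < p ^ r := Nat.one_lt_pow hr (Fact.out : p.Prime).one_lt
  have hset : (A : Set (F p)) =
      (Polynomial.X ^ p ^ r - Polynomial.X : Polynomial (F p)).rootSet (F p) := by
    ext x
    rw [Polynomial.mem_rootSet_of_ne (FiniteField.X_pow_card_sub_X_ne_zero _ h1)]
    simp [hA, sub_eq_zero]
  have hcard := Polynomial.card_rootSet_eq_natDegree
    (galois_poly_separable (K := F p) p (p ^ r) (dvd_pow_self p hr)) (IsAlgClosed.splits (k := F p) _)
  rw [FiniteField.X_pow_card_sub_X_natDegree_eq _ h1, ← Nat.card_eq_fintype_card, ← hset] at hcard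
  simpa using hcard

lemma sum_erase_translate {A : Finset (F p)} [DecidableEq (F p)]
    (hadd : ∀ x ∈ A, ∀ y ∈ A, x + y ∈ A) (hsub : ∀ x ∈ A, ∀ y ∈ A, x - y ∈ A)
    {v : F p} (hv : v ∈ A) {N : Type*} [AddCommMonoid N] (f : F p → N) :
    ∑ x ∈ A.erase 0, f (x + v) = ∑ y ∈ A.erase v, f y := by
  refine Finset.sum_nbij' (· + v) (· - v) ?_ ?_ ?_ ?_ ?_
  · intro x hx
    rw [Finset.mem_erase] at hx ⊢
    exact ⟨by simpa using hx.1, hadd _ hx.2 _ hv⟩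
  · intro x hx
    rw [Finset.mem_erase] at hx ⊢
    exact ⟨sub_ne_zero.2 hx.1, hsub _ hx.2 _ hv⟩
  all_goals simp

lemma sum_erase_inv_sub {A : Finset (F p)} [DecidableEq (F p)]
    (hsub : ∀ x ∈ A, ∀ y ∈ A, x - y ∈ A) (hinv : ∀ x ∈ A, x⁻¹ ∈ A)
    {u : F p} (hu : u ∈ A) {N : Type*} [AddCommMonoid N] (f : F p → N) :
    ∑ x ∈ (A.erase 0).erase u, f (u - x)⁻¹ = ∑ y ∈ (A.erase 0).erase u⁻¹, f y := by
  refine Finset.sum_nbij' (fun x => (u - x)⁻¹) (fun y => u - y⁻¹) ?_ ?_ ?_ ?_ ?_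
  · intro x hx
    simp only [Finset.mem_erase] at hx ⊢
    refine ⟨?_, inv_ne_zero (sub_ne_zero.2 hx.1.symm), hinv _ (hsub _ hu _ hx.2.2)⟩
    simpa using hx.2.1
  · intro y hy
    simp only [Finset.mem_erase] at hy ⊢
    refine ⟨by simpa using hy.2.1, ?_, hsub _ hu _ (hinv _ hy.2.2)⟩
    rw [sub_ne_zero]
    intro h'
    exact hy.1 (by rw [h', inv_inv])
  all_goals simp

/-- with `ζ_n = Σ_{x ∈ F_{q^n}, x ≠ 0} ρ_{x,0}`, for every nonzero
`u ∈ F_{q^n}` one has `s·ε(−u)·ζ_n = (qⁿ+1)·ρ_{u⁻¹,0} + (ε(u⁻¹) − 1)·ζ_n`. -/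
theorem stmt13 (hp2 : p ≠ 2) (q n : ℕ) (hq : ∃ m : ℕ, 0 < m ∧ q = p ^ m) (hn : 1 ≤ n)
    (Fqn : Finset (F p)) (hFqn : ∀ x : F p, x ∈ Fqn ↔ x ^ q ^ n = x)
    (u : F p) (hu : u ∈ Fqn) (hu0 : u ≠ 0) :
    gTT p k (sG p) (gTT p k (eps p (-u))
        (∑ x ∈ @Finset.erase (F p) (Classical.decEq (F p)) Fqn 0, ρ p k x 0)) =
      ((q ^ n + 1 : ℕ) : k) • ρ p k u⁻¹ 0 +
        (gTT p k (eps p u⁻¹)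
            (∑ x ∈ @Finset.erase (F p) (Classical.decEq (F p)) Fqn 0, ρ p k x 0) -
          ∑ x ∈ @Finset.erase (F p) (Classical.decEq (F p)) Fqn 0, ρ p k x 0) := by
  let _ := Classical.decEq (F p)
  obtain ⟨m, hm, rfl⟩ := hq
  have hr : m * n ≠ 0 := by positivity
  simp only [← pow_mul] at hFqn ⊢
  have hadd : ∀ x ∈ Fqn, ∀ y ∈ Fqn, x + y ∈ Fqn := by
    intro x hx y hy
    rw [hFqn] at *
    rw [add_pow_char_pow, hx, hy]
  have hsub : ∀ x ∈ Fqn, ∀ y ∈ Fqn, x - y ∈ Fqn := by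
    intro x hx y hy
    rw [hFqn] at *
    rw [sub_pow_char_pow, hx, hy]
  have hinv : ∀ x ∈ Fqn, x⁻¹ ∈ Fqn := by
    intro x hx
    rw [hFqn] at *
    rw [inv_pow, hx]
  have h0 : (0 : F p) ∈ Fqn := by simpa using hsub u hu u hu
  have hv : u⁻¹ ∈ Fqn := hinv u hu
  have hv0 : u⁻¹ ≠ 0 := inv_ne_zero hu0
  have hcard : (((Fqn.erase 0).erase u).card : k) + 2 = ((p ^ (m * n) : ℕ) : k) := by
    rw [← card_of_mem_iff_pow_eq p hr Fqn hFqn, ← Finset.card_erase_add_one h0,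
      ← Finset.card_erase_add_one (Finset.mem_erase.2 ⟨hu0, hu⟩)]
    push_cast
    ring
  have hterm : ∀ x ∈ (Fqn.erase 0).erase u,
      gTT p k (sG p) (ρ p k (x + -u) (0 + -u)) =
        (ρ p k (u - x)⁻¹ u⁻¹ - ρ p k (u - x)⁻¹ 0) + ρ p k u⁻¹ 0 := by
    intro x hx
    have hxu : x + -u ≠ 0 := by
      rw [← sub_eq_add_neg, sub_ne_zero]
      exact (Finset.mem_erase.1 hx).1
    rw [gTT_s_ρ p k hxu (by simpa using hu0)]
    simp [sub_eq_add_neg]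
  have hu_term : gTT p k (sG p) (ρ p k (u + -u) (0 + -u)) = ρ p k u⁻¹ 0 := by
    rw [add_neg_cancel, gTT_s_ρ_zero p k (by simpa using hu0)]
    simp
  have hsum : ∑ y ∈ (Fqn.erase 0).erase u⁻¹, (ρ p k y u⁻¹ - ρ p k y 0) =
      ∑ y ∈ (Fqn.erase 0).erase u⁻¹, ρ p k y u⁻¹ - ∑ y ∈ (Fqn.erase 0).erase u⁻¹, ρ p k y 0 := by
    rw [eq_sub_iff_add_eq, ← Finset.sum_add_distrib]
    simp only [sub_add_cancel]
  simp only [map_sum, gTT_eps_ρ]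
  rw [← Finset.add_sum_erase _ _ (Finset.mem_erase.2 ⟨hu0, hu⟩), hu_term,
    Finset.sum_congr rfl hterm, Finset.sum_add_distrib, Finset.sum_const,
    sum_erase_inv_sub p hsub hinv hu (fun y => ρ p k y u⁻¹ - ρ p k y 0),
    hsum,
    ← Finset.add_sum_erase _ (fun y => ρ p k y 0) (Finset.mem_erase.2 ⟨hv0, hv⟩)]
  simp only [zero_add]
  rw [sum_erase_translate p hadd hsub hv (fun y => ρ p k y u⁻¹),
    ← Finset.add_sum_erase _ _ (Finset.mem_erase.2 ⟨hv0.symm, h0⟩), Finset.erase_right_comm,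
    ρ_swap p k 0 u⁻¹, ← Nat.cast_smul_eq_nsmul k, Nat.cast_add, ← hcard]
  push_cast
  module

end SL2X
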